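/- Let A be the companion matrix of f(x) = (x-1)³(x²+x+1) and B the companion matrix of g(x) = (x+1)³(x²+1), and set T = B·A⁻¹ in GL(5,ℚ). Then T² = I with T ≠ I, B has infinite order, and the hypergeometric group Γ(f,g) = ⟨A,B⟩ is the free product of the subgroup generated by T and the subgroup generated by B: the canonical group homomorphism from the abstract free product (ℤ/2ℤ) ∗ ℤ to GL(5,ℚ) sending the generator of ℤ/2ℤ to T and the generator of ℤ to B is injective with image Γ(f,g). -/

import Mathlib

open Polynomial Matrix

/-- The companion matrix of a monic degree-5 rational polynomial `p`:
the `5 × 5` matrix whose entries in position `(i+1, i)` equal `1` for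
`i = 1, ..., 4`, whose last column is `(-p₀, -p₁, -p₂, -p₃, -p₄)ᵀ`
(where `pᵢ` is the coefficient of `xⁱ` in `p`), and whose remaining
entries are `0`. -/
def companionMatrix (p : ℚ[X]) : Matrix (Fin 5) (Fin 5) ℚ :=
  Matrix.of fun i j : Fin 5 =>
    if (j : ℕ) = 4 then -p.coeff i
    else if (i : ℕ) = (j : ℕ) + 1 then 1 else 0

/-- The family of groups `G`, `H` indexed by `Bool`. -/
def Monoid.Coprod.family (G H : Type) : Bool → Type
  | false => G
  | true => H

instance (G H : Type) [Group G] [Group H] : ∀ b, Group (Monoid.Coprod.family G H b)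
  | false => inferInstanceAs (Group G)
  | true => inferInstanceAs (Group H)

/-- The **ping-pong lemma** for the free product of two groups. -/
theorem Monoid.Coprod.lift_injective_of_ping_pong {G H : Type} {K α : Type*} [Group G] [Group H]
    [Group K] [MulAction K α] (f : G →* K) (g : H →* K) [Infinite H] (X Y : Set α)
    (hX : X.Nonempty) (hY : Y.Nonempty) (hXY : Disjoint X Y)
    (hf : ∀ x : G, x ≠ 1 → ∀ v ∈ Y, f x • v ∈ X)
    (hg : ∀ y : H, y ≠ 1 → ∀ v ∈ X, g y • v ∈ Y) :
    Function.Injective (Monoid.Coprod.lift f g) := by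
  let F : ∀ b, Monoid.Coprod.family G H b →* K := fun b => match b with
    | true => g
    | false => f
  let Z : Bool → Set α := fun b => cond b Y X
  have hF : Function.Injective (Monoid.CoprodI.lift F) := by
    refine Monoid.CoprodI.lift_injective_of_ping_pong F (Or.inr ⟨true, ?_⟩) Z ?_ ?_ ?_
    · exact (Cardinal.natCast_le_aleph0 (n := 3)).trans (Cardinal.aleph0_le_mk H)
    · rintro (_ | _)
      exacts [hX, hY]
    · rintro (_ | _) (_ | _) h
      exacts [absurd rfl h, hXY, hXY.symm, absurd rfl h]
    · rintro (_ | _) (_ | _) h x hx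
      · exact absurd rfl h
      · rintro _ ⟨v, hv, rfl⟩
        exact hf x hx v hv
      · rintro _ ⟨v, hv, rfl⟩
        exact hg x hx v hv
      · exact absurd rfl h
  let ψ : Monoid.Coprod G H →* Monoid.CoprodI (Monoid.Coprod.family G H) :=
    Monoid.Coprod.lift (Monoid.CoprodI.of (M := Monoid.Coprod.family G H) (i := false))
      (Monoid.CoprodI.of (M := Monoid.Coprod.family G H) (i := true))
  let inclusions : ∀ b, Monoid.Coprod.family G H b →* Monoid.Coprod G H := fun b => match b with
    | true => Monoid.Coprod.inr
    | false => Monoid.Coprod.inl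
  have hψl (x : G) :
      ψ (Monoid.Coprod.inl x) = Monoid.CoprodI.of (M := Monoid.Coprod.family G H) (i := false) x :=
    Monoid.Coprod.lift_apply_inl _ _ x
  have hψr (x : H) :
      ψ (Monoid.Coprod.inr x) = Monoid.CoprodI.of (M := Monoid.Coprod.family G H) (i := true) x :=
    Monoid.Coprod.lift_apply_inr _ _ x
  have hψ : (Monoid.CoprodI.lift inclusions).comp ψ = MonoidHom.id _ := by
    ext x
    · exact (congrArg (Monoid.CoprodI.lift inclusions) (hψl x)).trans
        (Monoid.CoprodI.lift_of (i := false) inclusions x)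
    · exact (congrArg (Monoid.CoprodI.lift inclusions) (hψr x)).trans
        (Monoid.CoprodI.lift_of (i := true) inclusions x)
  have hFψ : Monoid.Coprod.lift f g = (Monoid.CoprodI.lift F).comp ψ := by
    ext x
    · exact (Monoid.Coprod.lift_apply_inl f g x).trans
        ((congrArg (Monoid.CoprodI.lift F) (hψl x)).trans
          (Monoid.CoprodI.lift_of (i := false) F x)).symm
    · exact (Monoid.Coprod.lift_apply_inr f g x).trans
        ((congrArg (Monoid.CoprodI.lift F) (hψr x)).trans
          (Monoid.CoprodI.lift_of (i := true) F x)).symm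
  rw [hFψ, MonoidHom.coe_comp]
  exact hF.comp (Function.LeftInverse.injective (g := Monoid.CoprodI.lift inclusions)
    fun x => DFunLike.congr_fun hψ x)

/-- Invertible matrices act on column vectors. -/
abbrev mulVecAction : MulAction (GL (Fin 5) ℚ) (Fin 5 → ℚ) where
  smul M v := (M : Matrix (Fin 5) (Fin 5) ℚ) *ᵥ v
  one_smul v := Matrix.one_mulVec v
  mul_smul M N v := (Matrix.mulVec_mulVec v M.val N.val).symm

theorem companionMatrix_f :
    companionMatrix ((X - 1) ^ 3 * (X ^ 2 + X + 1)) =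
      !![0, 0, 0, 0, 1; 1, 0, 0, 0, -2; 0, 1, 0, 0, 1; 0, 0, 1, 0, -1; 0, 0, 0, 1, 2] := by
  have h : ((X - 1) ^ 3 * (X ^ 2 + X + 1) : ℚ[X]) =
      X ^ 5 + C (-2) * X ^ 4 + C 1 * X ^ 3 + C (-1) * X ^ 2 + C 2 * X + C (-1) := by
    simp only [map_neg, map_one, map_ofNat]
    ring
  rw [h]
  ext i j
  fin_cases i <;> fin_cases j <;> simp [companionMatrix, coeff_X, coeff_X_pow, coeff_one]

theorem companionMatrix_g :
    companionMatrix ((X + 1) ^ 3 * (X ^ 2 + 1)) =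
      !![0, 0, 0, 0, -1; 1, 0, 0, 0, -3; 0, 1, 0, 0, -4; 0, 0, 1, 0, -4; 0, 0, 0, 1, -3] := by
  have h : ((X + 1) ^ 3 * (X ^ 2 + 1) : ℚ[X]) =
      X ^ 5 + C 3 * X ^ 4 + C 4 * X ^ 3 + C 4 * X ^ 2 + C 3 * X + C 1 := by
    simp only [map_one, map_ofNat]
    ring
  rw [h]
  ext i j
  fin_cases i <;> fin_cases j <;> simp [companionMatrix, coeff_X, coeff_X_pow, coeff_one]

/-- The matrix of `B * A⁻¹`. -/
def reflectionMatrix : Matrix (Fin 5) (Fin 5) ℚ :=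
  !![-1, 0, 0, 0, 0; -1, 1, 0, 0, 0; -5, 0, 1, 0, 0; -3, 0, 0, 1, 0; -5, 0, 0, 0, 1]

/-- Coordinates in which `-B` is the sum of a unipotent block `(a, b, c) ↦ (a + b + c, b + 2c, c)`
and a quarter turn `(d, e) ↦ (e, -d)`. -/
structure Coords where
  (a b c d e : ℚ)

namespace Coords

/-- The coordinates of a vector. -/
def ofVec (v : Fin 5 → ℚ) : Coords where
  a := 5 * v 0 - v 1 - v 2 + v 3 + v 4
  b := -5 * v 0 + 3 * v 1 - v 2 - v 3 + 3 * v 4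
  c := v 0 - v 1 + v 2 - v 3 + v 4
  d := -v 0 + v 1 + v 2 - v 3 - v 4
  e := -v 0 - v 1 + v 2 + v 3 - v 4

/-- Four times the Lorentzian form preserved by the hypergeometric group. -/
def form (u : Coords) : ℚ :=
  4 * u.a * u.c - u.b ^ 2 - 3 * u.c ^ 2 - 4 * u.d ^ 2 - 4 * u.e ^ 2

/-- The side of the hyperplane `2a - c + 4d = 0` on which a time-like line lies, as the sign of
this number: `c` is positive on one half of the light cone and negative on the other. -/
def side (u : Coords) : ℚ := u.c * (2 * u.a - u.c + 4 * u.d)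

theorem side_neg_of_side_pos {u : Coords} (hQ : 0 < u.form) (hu : 0 < u.side) :
    side ⟨u.a - 3 * (u.a + u.d), u.b, u.c - 2 * (u.a + u.d), u.d + (u.a + u.d), u.e⟩ < 0 := by
  have hneg : (u.c - 2 * (u.a + u.d)) * u.c < 0 := by
    simp only [form] at hQ
    nlinarith [sq_nonneg (2 * u.d + u.c), sq_nonneg u.b, sq_nonneg u.e]
  have hprod := mul_neg_of_neg_of_pos hneg hu
  refine neg_of_mul_neg_left (b := u.c ^ 2) ?_ (sq_nonneg u.c)
  convert hprod using 1
  simp only [side]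
  ring

/-- The second point is, up to sign, the image of the first under the `n`-th power of `B`. -/
def IsTranslate (n : ℤ) (u u' : Coords) : Prop :=
  ∃ s : ℚ, s ^ 2 = 1 ∧ u'.a = s * (u.a + n * u.b + n ^ 2 * u.c) ∧ u'.b = s * (u.b + 2 * n * u.c) ∧
    u'.c = s * u.c ∧
    (n % 4 = 0 ∧ u'.d = s * u.d ∧ u'.e = s * u.e ∨
      n % 4 = 1 ∧ u'.d = s * u.e ∧ u'.e = -s * u.d ∨
      n % 4 = 2 ∧ u'.d = -s * u.d ∧ u'.e = -s * u.e ∨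
      n % 4 = 3 ∧ u'.d = -s * u.e ∧ u'.e = s * u.d)

theorem IsTranslate.form_eq {n : ℤ} {u u' : Coords} (h : IsTranslate n u u') :
    u'.form = u.form := by
  obtain ⟨s, hs, ha, hb, hc, h⟩ := h
  suffices u'.form = s ^ 2 * u.form by rw [this, hs, one_mul]
  rcases h with h | h | h | h <;>
  · obtain ⟨-, hd, he⟩ := h
    simp only [form, ha, hb, hc, hd, he]
    ring

theorem IsTranslate.side_pos {n : ℤ} {u u' : Coords} (h : IsTranslate n u u') (hn : n ≠ 0)
    (hQ : 0 < u.form) (hu : u.side < 0) : 0 < u'.side := by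
  obtain ⟨s, hs, ha, hb, hc, h⟩ := h
  have hn1 : (1 : ℚ) ≤ (n : ℚ) ^ 2 := by
    exact_mod_cast Order.one_le_iff_pos.mpr (sq_pos_of_ne_zero hn)
  have hcn : 0 ≤ u.c ^ 2 * ((n : ℚ) ^ 2 - 1) := mul_nonneg (sq_nonneg _) (by linarith)
  simp only [form, side] at hQ hu
  have key (x : ℚ) (hx : 0 ≤ 4 * u.d ^ 2 + 4 * u.e ^ 2 + 4 * u.c * (u.d + x) + (n ^ 2 + 1) * u.c ^ 2)
      (hd : u'.d = s * x) : 0 < u'.side := by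
    have : u'.side = s ^ 2 * (u.c * (2 * (u.a + n * u.b + n ^ 2 * u.c) - u.c + 4 * x)) := by
      simp only [side, ha, hc, hd]
      ring
    rw [this, hs, one_mul]
    nlinarith [sq_nonneg (u.b + n * u.c)]
  rcases h with ⟨hn4, hd, -⟩ | ⟨-, hd, -⟩ | ⟨-, hd, -⟩ | ⟨-, hd, -⟩
  · refine key u.d ?_ hd
    have hn16 : (16 : ℚ) ≤ (n : ℚ) ^ 2 := by
      obtain ⟨m, rfl⟩ := Int.dvd_of_emod_eq_zero hn4
      have : (1 : ℤ) ≤ m ^ 2 := 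
        Order.one_le_iff_pos.mpr (sq_pos_of_ne_zero (by rintro rfl; simp at hn))
      have : (1 : ℚ) ≤ (m : ℚ) ^ 2 := by exact_mod_cast this
      push_cast
      linarith
    have : 0 ≤ u.c ^ 2 * ((n : ℚ) ^ 2 - 16) := mul_nonneg (sq_nonneg _) (by linarith)
    nlinarith [sq_nonneg (u.d + u.c), sq_nonneg u.e, sq_nonneg u.c]
  · refine key u.e ?_ hd
    nlinarith [sq_nonneg (2 * u.d + u.c), sq_nonneg (2 * u.e + u.c)]
  · refine key (-u.d) ?_ (by rw [hd]; ring)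
    nlinarith [sq_nonneg u.d, sq_nonneg u.e, sq_nonneg u.c]
  · refine key (-u.e) ?_ (by rw [hd]; ring)
    nlinarith [sq_nonneg (2 * u.d + u.c), sq_nonneg (2 * u.e - u.c)]

end Coords

section Action

attribute [local instance] mulVecAction

theorem mulVecAction_smul_def (M : GL (Fin 5) ℚ) (v : Fin 5 → ℚ) :
    M • v = (M : Matrix (Fin 5) (Fin 5) ℚ) *ᵥ v := rfl

theorem smul_eq_of_coe_eq_companionMatrix_g {B : GL (Fin 5) ℚ}
    (hB : (B : Matrix (Fin 5) (Fin 5) ℚ) = companionMatrix ((X + 1) ^ 3 * (X ^ 2 + 1)))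
    (v : Fin 5 → ℚ) :
    B • v = ![-v 4, v 0 - 3 * v 4, v 1 - 4 * v 4, v 2 - 4 * v 4, v 3 - 3 * v 4] := by
  rw [mulVecAction_smul_def, hB, companionMatrix_g]
  ext i
  fin_cases i <;> simp [Matrix.mulVec, dotProduct, Fin.sum_univ_five] <;> ring

theorem isTranslate_zpow_smul {B : GL (Fin 5) ℚ}
    (hB : (B : Matrix (Fin 5) (Fin 5) ℚ) = companionMatrix ((X + 1) ^ 3 * (X ^ 2 + 1)))
    (n : ℤ) (v : Fin 5 → ℚ) :
    Coords.IsTranslate n (Coords.ofVec v) (Coords.ofVec (B ^ n • v)) := by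
  have step (w : Fin 5 → ℚ) :
      (Coords.ofVec (B • w)).a =
        -((Coords.ofVec w).a + (Coords.ofVec w).b + (Coords.ofVec w).c) ∧
      (Coords.ofVec (B • w)).b = -((Coords.ofVec w).b + 2 * (Coords.ofVec w).c) ∧
      (Coords.ofVec (B • w)).c = -(Coords.ofVec w).c ∧
      (Coords.ofVec (B • w)).d = -(Coords.ofVec w).e ∧
      (Coords.ofVec (B • w)).e = (Coords.ofVec w).d := by
    rw [smul_eq_of_coe_eq_companionMatrix_g hB]
    refine ⟨?_, ?_, ?_, ?_, ?_⟩ <;> simp [Coords.ofVec] <;> ring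
  induction n using Int.induction_on with
  | zero => exact ⟨1, by simp⟩
  | succ n ih =>
    obtain ⟨s, hs, ha, hb, hc, h⟩ := ih
    obtain ⟨ha', hb', hc', hd', he'⟩ := step (B ^ (n : ℤ) • v)
    rw [smul_smul, ← _root_.zpow_one_add, add_comm 1 (n : ℤ)] at ha' hb' hc' hd' he'
    refine ⟨-s, by rw [neg_sq, hs], ?_, ?_, ?_, ?_⟩
    · rw [ha', ha, hb, hc]; push_cast; ring
    · rw [hb', hb, hc]; push_cast; ring
    · rw [hc', hc]; ring
    · rw [hd', he']
      rcases h with ⟨hn, hd, he⟩ | ⟨hn, hd, he⟩ | ⟨hn, hd, he⟩ | ⟨hn, hd, he⟩ <;> rw [hd, he]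
      · exact Or.inr (Or.inl ⟨by omega, by ring, by ring⟩)
      · exact Or.inr (Or.inr (Or.inl ⟨by omega, by ring, by ring⟩))
      · exact Or.inr (Or.inr (Or.inr ⟨by omega, by ring, by ring⟩))
      · exact Or.inl ⟨by omega, by ring, by ring⟩
  | pred n ih =>
    obtain ⟨s, hs, ha, hb, hc, h⟩ := ih
    obtain ⟨ha', hb', hc', hd', he'⟩ := step (B ^ (-(n : ℤ) - 1) • v)
    rw [smul_smul, ← _root_.zpow_one_add, add_sub_cancel] at ha' hb' hc' hd' he'
    have hc'' : (Coords.ofVec (B ^ (-(n : ℤ) - 1) • v)).c = -s * (Coords.ofVec v).c := by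
      linarith
    have hb'' : (Coords.ofVec (B ^ (-(n : ℤ) - 1) • v)).b =
        -s * ((Coords.ofVec v).b + 2 * (-(n : ℤ) - 1 : ℤ) * (Coords.ofVec v).c) := by
      push_cast at hb ⊢
      linarith
    refine ⟨-s, by rw [neg_sq, hs], ?_, hb'', hc'', ?_⟩
    · push_cast at ha hb'' ⊢
      linarith
    · rcases h with ⟨hn, hd, he⟩ | ⟨hn, hd, he⟩ | ⟨hn, hd, he⟩ | ⟨hn, hd, he⟩
      · exact Or.inr (Or.inr (Or.inr ⟨by omega, by linarith, by linarith⟩))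
      · exact Or.inl ⟨by omega, by linarith, by linarith⟩
      · exact Or.inr (Or.inl ⟨by omega, by linarith, by linarith⟩)
      · exact Or.inr (Or.inr (Or.inl ⟨by omega, by linarith, by linarith⟩))

theorem smul_eq_of_coe_eq_reflectionMatrix {T : GL (Fin 5) ℚ}
    (hT : (T : Matrix (Fin 5) (Fin 5) ℚ) = reflectionMatrix) (v : Fin 5 → ℚ) :
    T • v = ![-v 0, v 1 - v 0, v 2 - 5 * v 0, v 3 - 3 * v 0, v 4 - 5 * v 0] := by
  rw [mulVecAction_smul_def, hT, reflectionMatrix]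
  ext i
  fin_cases i <;> simp [Matrix.mulVec, dotProduct, Fin.sum_univ_five] <;> ring

theorem reflection_ping_pong {T : GL (Fin 5) ℚ}
    (hT : (T : Matrix (Fin 5) (Fin 5) ℚ) = reflectionMatrix) {v : Fin 5 → ℚ}
    (hQ : 0 < (Coords.ofVec v).form) (hv : 0 < (Coords.ofVec v).side) :
    0 < (Coords.ofVec (T • v)).form ∧ (Coords.ofVec (T • v)).side < 0 := by
  rw [smul_eq_of_coe_eq_reflectionMatrix hT]
  constructor
  · convert hQ using 1
    simp [Coords.form, Coords.ofVec]
    ring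
  · convert Coords.side_neg_of_side_pos hQ hv using 2
    simp only [Coords.ofVec, Coords.mk.injEq]
    refine ⟨?_, ?_, ?_, ?_, ?_⟩ <;> simp <;> ring

theorem lift_injective_of_coe_eq {B T : GL (Fin 5) ℚ}
    (hB : (B : Matrix (Fin 5) (Fin 5) ℚ) = companionMatrix ((X + 1) ^ 3 * (X ^ 2 + 1)))
    (hT : (T : Matrix (Fin 5) (Fin 5) ℚ) = reflectionMatrix)
    (f : Multiplicative (ZMod 2) →* GL (Fin 5) ℚ)
    (hf : f (Multiplicative.ofAdd (1 : ZMod 2)) = T) :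
    Function.Injective (Monoid.Coprod.lift f (zpowersHom _ B)) := by
  refine Monoid.Coprod.lift_injective_of_ping_pong (α := Fin 5 → ℚ) f (zpowersHom _ B)
    {v | 0 < (Coords.ofVec v).form ∧ (Coords.ofVec v).side < 0}
    {v | 0 < (Coords.ofVec v).form ∧ 0 < (Coords.ofVec v).side} ?_ ?_ ?_ ?_ ?_
  · exact ⟨![1, 0, 2, 2, 3], by simp [Coords.form, Coords.side, Coords.ofVec]; norm_num⟩
  · exact ⟨![1, 1, 3, 1, 2], by simp [Coords.form, Coords.side, Coords.ofVec]; norm_num⟩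
  · exact Set.disjoint_left.mpr fun v hv hv' => lt_asymm hv.2 hv'.2
  · rintro x hx v ⟨hQ, hv⟩
    have hx1 : x = Multiplicative.ofAdd (1 : ZMod 2) := by
      revert x
      decide
    rw [hx1, hf]
    exact reflection_ping_pong hT hQ hv
  · rintro n hn v ⟨hQ, hv⟩
    have h := isTranslate_zpow_smul hB n.toAdd v
    exact ⟨h.form_eq ▸ hQ, h.side_pos (fun h0 => hn (toAdd_eq_zero.mp h0)) hQ hv⟩

end Action

/-- `Γ(f,g) = ⟨T⟩ ∗ ⟨B⟩` for `f = ((X - 1) ^ 3 * (X ^ 2 + X + 1))`, `g = ((X + 1) ^ 3 * (X ^ 2 + 1))`. -/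
theorem hypergeometric_free_product_case12 (A B T : GL (Fin 5) ℚ)
    (hA : (↑A : Matrix (Fin 5) (Fin 5) ℚ) = companionMatrix ((X - 1) ^ 3 * (X ^ 2 + X + 1)))
    (hB : (↑B : Matrix (Fin 5) (Fin 5) ℚ) = companionMatrix ((X + 1) ^ 3 * (X ^ 2 + 1)))
    (hT : T = B * A⁻¹) :
    T ^ 2 = 1 ∧ T ≠ 1 ∧ ¬ IsOfFinOrder B ∧
    ∃ φ : Monoid.Coprod (Multiplicative (ZMod 2)) (Multiplicative ℤ) →* GL (Fin 5) ℚ,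
      φ (Monoid.Coprod.inl (Multiplicative.ofAdd (1 : ZMod 2))) = T ∧
      φ (Monoid.Coprod.inr (Multiplicative.ofAdd (1 : ℤ))) = B ∧
      Function.Injective φ ∧
      φ.range = Subgroup.closure {A, B} := by
  have hTM : (T : Matrix (Fin 5) (Fin 5) ℚ) = reflectionMatrix := by
    have h : (B : Matrix (Fin 5) (Fin 5) ℚ) = reflectionMatrix * A := by
      rw [hA, hB, companionMatrix_f, companionMatrix_g, reflectionMatrix]
      ext i j
      fin_cases i <;> fin_cases j <;> simp [Matrix.mul_apply, Fin.sum_univ_five] <;> norm_num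
    rw [hT, Units.val_mul, h, mul_assoc, Units.mul_inv, mul_one]
  have hT2 : T ^ 2 = 1 := by
    ext i j
    rw [Units.val_pow_eq_pow_val, hTM, sq, reflectionMatrix]
    fin_cases i <;> fin_cases j <;> simp [Matrix.mul_apply, Fin.sum_univ_five]
  have hT2_add : zmultiplesHom _ (Additive.ofMul T) (2 : ℕ) = 0 := by
    rw [zmultiplesHom_apply, natCast_zsmul, ← ofMul_pow, hT2, ofMul_one]
  let f : Multiplicative (ZMod 2) →* GL (Fin 5) ℚ := AddMonoidHom.toMultiplicativeLeft
    (ZMod.lift 2 ⟨zmultiplesHom _ (Additive.ofMul T), hT2_add⟩)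
  have hf : f (Multiplicative.ofAdd (1 : ZMod 2)) = T := by
    have h := ZMod.lift_coe 2 (⟨zmultiplesHom _ (Additive.ofMul T), hT2_add⟩ :
        {g : ℤ →+ Additive (GL (Fin 5) ℚ) // g (2 : ℕ) = 0}) 1
    rw [Int.cast_one, zmultiplesHom_apply, one_zsmul] at h
    exact congrArg Additive.toMul h
  have hinj := lift_injective_of_coe_eq hB hTM f hf
  have hinl : Monoid.Coprod.lift f (zpowersHom _ B)
      (Monoid.Coprod.inl (Multiplicative.ofAdd (1 : ZMod 2))) = T := by
    rw [Monoid.Coprod.lift_apply_inl, hf]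
  have hinr : Monoid.Coprod.lift f (zpowersHom _ B)
      (Monoid.Coprod.inr (Multiplicative.ofAdd (1 : ℤ))) = B := by
    simp [Monoid.Coprod.lift_apply_inr]
  have hBzpow : Function.Injective (zpowersHom _ B) := fun m n h =>
    Monoid.Coprod.inr_injective (hinj (by simpa only [Monoid.Coprod.lift_apply_inr] using h))
  refine ⟨hT2, ?_, ?_, Monoid.Coprod.lift f (zpowersHom _ B), hinl, hinr, hinj, ?_⟩
  · intro h
    have h00 := congrFun (congrFun (hTM.symm.trans (congrArg Units.val h)) 0) 0
    norm_num [reflectionMatrix] at h00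
  · rw [← injective_zpow_iff_not_isOfFinOrder]
    exact hBzpow
  · have hrange : f.range = Subgroup.zpowers T := by
      refine le_antisymm ?_ (Subgroup.zpowers_le.mpr ⟨_, hf⟩)
      rintro _ ⟨x, rfl⟩
      have hx : x = 1 ∨ x = Multiplicative.ofAdd (1 : ZMod 2) := by
        revert x
        decide
      rcases hx with rfl | rfl
      · rw [map_one]
        exact one_mem _
      · rw [hf]
        exact Subgroup.mem_zpowers T
    have hzpowers : (zpowersHom _ B).range = Subgroup.zpowers B := rfl
    rw [Monoid.Coprod.range_lift, hrange, hzpowers]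
    apply le_antisymm
    · have hAmem : A ∈ Subgroup.closure {A, B} := Subgroup.subset_closure (by simp)
      have hBmem : B ∈ Subgroup.closure {A, B} := Subgroup.subset_closure (by simp)
      rw [sup_le_iff, Subgroup.zpowers_le, Subgroup.zpowers_le]
      exact ⟨hT ▸ mul_mem hBmem (inv_mem hAmem), hBmem⟩
    · have hTmem : T ∈ Subgroup.zpowers T ⊔ Subgroup.zpowers B :=
        Subgroup.mem_sup_left (Subgroup.mem_zpowers T)
      have hBmem : B ∈ Subgroup.zpowers T ⊔ Subgroup.zpowers B :=
        Subgroup.mem_sup_right (Subgroup.mem_zpowers B)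
      have hA_eq : A = T⁻¹ * B := by rw [hT, _root_.mul_inv_rev, inv_inv, inv_mul_cancel_right]
      rw [Subgroup.closure_le]
      rintro _ (rfl | rfl)
      · rw [SetLike.mem_coe, hA_eq]
        exact mul_mem (inv_mem hTmem) hBmem
      · exact hBmem
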